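/- arXiv:1708.07330 — 2 statements merged into one kernel-verified Lean document; each statement's English description precedes it below -/
import Mathlib

section
/- Let C be an integral d-uniform clutter on [n] whose edges cover [n] (every vertex lies in some edge). Then there exist pairwise disjoint minimal vertex covers V_1, …, V_d of C with [n] = V_1 ∪ ⋯ ∪ V_d; in particular |e ∩ V_i| = 1 for every edge e of C and every 1 ≤ i ≤ d. Consequently C is a d-partite clutter. -/
/-- The set covering polyhedron of a clutter with edge set `E` on `[n]`:
`Q = {x ∈ ℝ^n : x ≥ 0 and Σ_{i ∈ e} x_i ≥ 1 for every edge e}`. -/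
def coveringPolyhedron {n : ℕ} (E : Finset (Finset (Fin n))) : Set (Fin n → ℝ) :=
  {x | (∀ i, 0 ≤ x i) ∧ ∀ e ∈ E, 1 ≤ ∑ i ∈ e, x i}

/-- A vertex cover of the clutter with edge set `E`: a set of vertices meeting every edge. -/
def IsVertexCover {n : ℕ} (E : Finset (Finset (Fin n))) (W : Finset (Fin n)) : Prop :=
  ∀ e ∈ E, (e ∩ W).Nonempty

/-- A minimal vertex cover: a vertex cover no proper subset of which is a vertex cover. -/
def IsMinimalVertexCover {n : ℕ} (E : Finset (Finset (Fin n))) (W : Finset (Fin n)) : Prop :=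
  IsVertexCover E W ∧ ∀ W' ⊂ W, ¬ IsVertexCover E W'

/-- A clutter is integral if every extreme point of its set covering polyhedron has
integer coordinates. -/
def IsIntegralClutter {n : ℕ} (E : Finset (Finset (Fin n))) : Prop :=
  ∀ x ∈ Set.extremePoints ℝ (coveringPolyhedron E), ∀ i, ∃ z : ℤ, x i = (z : ℝ)

/-- The points of the covering polyhedron that vanish off `S` and are tight on every edge. -/
def tightFace {n : ℕ} (E : Finset (Finset (Fin n))) (S : Finset (Fin n)) : Set (Fin n → ℝ) :=
  {x | (∀ i, 0 ≤ x i) ∧ (∀ i, i ∉ S → x i = 0) ∧ ∀ e ∈ E, ∑ i ∈ e, x i = 1}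

theorem isExtreme_tightFace {n : ℕ} (E : Finset (Finset (Fin n))) (S : Finset (Fin n)) :
    IsExtreme ℝ (coveringPolyhedron E) (tightFace E S) := by
  refine ⟨fun x hx => ⟨hx.1, fun e he => (hx.2.2 e he).ge⟩, ?_⟩
  rintro y hy z hz x hx ⟨a, b, ha, hb, hab, rfl⟩
  refine ⟨hy.1, fun i hi => ?_, fun e he => ?_⟩
  · have h := hx.2.1 i hi
    simp only [Pi.add_apply, Pi.smul_apply, smul_eq_mul] at h
    have h1 := mul_nonneg ha.le (hy.1 i)
    have h2 := mul_nonneg hb.le (hz.1 i)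
    have h3 : a * y i = 0 := by linarith
    exact (mul_eq_zero.1 h3).resolve_left ha.ne'
  · have h := hx.2.2 e he
    simp only [Pi.add_apply, Pi.smul_apply, smul_eq_mul, Finset.sum_add_distrib,
      ← Finset.mul_sum] at h
    have h1 := mul_nonneg ha.le (sub_nonneg.2 (hy.2 e he))
    have h2 := mul_nonneg hb.le (sub_nonneg.2 (hz.2 e he))
    have h3 : a * (∑ i ∈ e, y i - 1) = 0 := by linarith
    exact sub_eq_zero.1 ((mul_eq_zero.1 h3).resolve_left ha.ne')

theorem tightFace_apply_le_one {n : ℕ} {E : Finset (Finset (Fin n))} {S : Finset (Fin n)}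
    (h_cover : ∀ x : Fin n, ∃ e ∈ E, x ∈ e) {x : Fin n → ℝ} (hx : x ∈ tightFace E S)
    (i : Fin n) : x i ≤ 1 := by
  obtain ⟨e, he, hi⟩ := h_cover i
  exact hx.2.2 e he ▸ Finset.single_le_sum (f := x) (fun j _ => hx.1 j) hi

theorem isCompact_tightFace {n : ℕ} {E : Finset (Finset (Fin n))}
    (h_cover : ∀ x : Fin n, ∃ e ∈ E, x ∈ e) (S : Finset (Fin n)) :
    IsCompact (tightFace E S) := by
  refine (isCompact_Icc (a := (0 : Fin n → ℝ)) (b := 1)).of_isClosed_subset ?_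
    fun x hx => ⟨hx.1, tightFace_apply_le_one h_cover hx⟩
  simp only [tightFace, Set.ofPred_and, Set.ofPred_forall]
  refine IsClosed.inter ?_ (IsClosed.inter ?_ ?_)
  · exact isClosed_iInter fun i => isClosed_le continuous_const (continuous_apply i)
  · exact isClosed_iInter fun i => isClosed_iInter fun _ =>
      isClosed_eq (continuous_apply i) continuous_const
  · exact isClosed_iInter fun e => isClosed_iInter fun _ =>
      isClosed_eq (by fun_prop) continuous_const

theorem tightFace_nonempty {n k : ℕ} {E : Finset (Finset (Fin n))} {S : Finset (Fin n)}
    (h_card : ∀ e ∈ E, (e ∩ S).card = k + 1) : (tightFace E S).Nonempty := by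
  refine ⟨fun i => if i ∈ S then ((k : ℝ) + 1)⁻¹ else 0, fun i => ?_, fun i hi => if_neg hi,
    fun e he => ?_⟩
  · dsimp only
    split_ifs <;> positivity
  · rw [← Finset.sum_filter, Finset.filter_mem_eq_inter, Finset.sum_const, h_card e he,
      nsmul_eq_mul]
    push_cast
    exact mul_inv_cancel₀ (by positivity)

/-- If all edges of an integral clutter meet `S` in the same positive number of vertices, then
`S` contains a set meeting every edge exactly once. -/
theorem IsIntegralClutter.exists_exact_transversal {n k : ℕ} {E : Finset (Finset (Fin n))}
    (h_integral : IsIntegralClutter E) (h_cover : ∀ x : Fin n, ∃ e ∈ E, x ∈ e)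
    {S : Finset (Fin n)} (h_card : ∀ e ∈ E, (e ∩ S).card = k + 1) :
    ∃ V ⊆ S, ∀ e ∈ E, (e ∩ V).card = 1 := by
  obtain ⟨x, hx⟩ := (isCompact_tightFace h_cover S).extremePoints_nonempty
    (tightFace_nonempty h_card)
  have hxF : x ∈ tightFace E S := hx.1
  have hx01 : ∀ i, x i = if x i = 1 then 1 else 0 := by
    intro i
    obtain ⟨z, hz⟩ :=
      h_integral x ((isExtreme_tightFace E S).extremePoints_subset_extremePoints hx) i
    have h0 := hxF.1 i
    have h1 := tightFace_apply_le_one h_cover hxF i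
    rw [hz] at h0 h1 ⊢
    norm_cast at h0 h1 ⊢
    split_ifs <;> omega
  refine ⟨Finset.univ.filter fun i => x i = 1, fun i hi => ?_, fun e he => ?_⟩
  · by_contra hiS
    simp [hxF.2.1 i hiS] at hi
  · have h := hxF.2.2 e he
    rw [Finset.sum_congr rfl fun i _ => hx01 i, Finset.sum_boole] at h
    rw [← Finset.filter_mem_eq_inter]
    simpa using h

theorem IsIntegralClutter.exists_partition {n : ℕ} {E : Finset (Finset (Fin n))}
    (h_integral : IsIntegralClutter E) (h_cover : ∀ x : Fin n, ∃ e ∈ E, x ∈ e) (k : ℕ)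
    (S : Finset (Fin n)) (h_card : ∀ e ∈ E, (e ∩ S).card = k) :
    ∃ V : Fin k → Finset (Fin n), (∀ i, V i ⊆ S) ∧ (∀ i j, i ≠ j → Disjoint (V i) (V j)) ∧
      (∀ x ∈ S, ∃ i, x ∈ V i) ∧ ∀ e ∈ E, ∀ i, (e ∩ V i).card = 1 := by
  induction k generalizing S with
  | zero =>
    refine ⟨Fin.elim0, fun i => i.elim0, fun i => i.elim0, fun x hx => ?_, fun _ _ i => i.elim0⟩
    obtain ⟨e, he, hxe⟩ := h_cover x
    have h := Finset.card_eq_zero.1 (h_card e he)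
    exact absurd (Finset.mem_inter.2 ⟨hxe, hx⟩) (h ▸ Finset.notMem_empty x)
  | succ k ih =>
    obtain ⟨W, hWS, hW⟩ := h_integral.exists_exact_transversal h_cover h_card
    obtain ⟨V, hVS, hdisj, hcov, hV⟩ := ih (S \ W) fun e he => by
      rw [← Finset.inter_sdiff_assoc, ← Finset.sdiff_inter_self_left]
      have h : e ∩ S ∩ W = e ∩ W := by
        rw [Finset.inter_assoc, Finset.inter_eq_right.2 hWS]
      rw [h, Finset.card_sdiff_of_subset (h ▸ Finset.inter_subset_left), h_card e he, hW e he,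
        Nat.add_sub_cancel]
    have hWV : ∀ i, Disjoint W (V i) := fun i =>
      Finset.disjoint_of_subset_right (hVS i) Finset.disjoint_sdiff
    refine ⟨Fin.cons W V, fun i => ?_, fun i j hij => ?_, fun x hx => ?_, fun e he i => ?_⟩
    · refine Fin.cases hWS (fun i => ?_) i
      exact (hVS i).trans Finset.sdiff_subset
    · induction i using Fin.cases with
      | zero =>
        induction j using Fin.cases with
        | zero => exact absurd rfl hij
        | succ j => exact hWV j
      | succ i =>
        induction j using Fin.cases with
        | zero => exact (hWV i).symm
        | succ j => exact hdisj i j fun h => hij (h ▸ rfl)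
    · by_cases hxW : x ∈ W
      · exact ⟨0, hxW⟩
      · obtain ⟨i, hi⟩ := hcov x (Finset.mem_sdiff.2 ⟨hx, hxW⟩)
        exact ⟨i.succ, hi⟩
    · exact Fin.cases (hW e he) (fun i => hV e he i) i

theorem isMinimalVertexCover_of_card_inter_eq_one {n : ℕ} {E : Finset (Finset (Fin n))}
    (h_cover : ∀ x : Fin n, ∃ e ∈ E, x ∈ e) {W : Finset (Fin n)}
    (hW : ∀ e ∈ E, (e ∩ W).card = 1) : IsMinimalVertexCover E W := by
  refine ⟨fun e he => Finset.card_pos.1 (hW e he ▸ one_pos), fun W' hW' hcov => ?_⟩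
  obtain ⟨x, hxW, hxW'⟩ := Finset.exists_of_ssubset hW'
  obtain ⟨e, he, hxe⟩ := h_cover x
  obtain ⟨y, hy⟩ := hcov e he
  rw [Finset.mem_inter] at hy
  have hyx : y = x := Finset.card_le_one.1 (hW e he).le y
    (Finset.mem_inter.2 ⟨hy.1, hW'.subset hy.2⟩) x (Finset.mem_inter.2 ⟨hxe, hxW⟩)
  exact hxW' (hyx ▸ hy.2)

/-- If `C` is an integral `d`-uniform clutter on `[n]` whose edges cover `[n]`, then `[n]`
can be partitioned into `d` pairwise disjoint minimal vertex covers `V 0, …, V (d-1)`;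
in particular `|e ∩ V i| = 1` for every edge `e` and every `i`, so `C` is `d`-partite. -/
theorem integral_uniform_clutter_partition_into_covers {n d : ℕ} (hd : 1 ≤ d)
    (E : Finset (Finset (Fin n)))
    (h_uniform : ∀ e ∈ E, e.card = d)
    (h_antichain : ∀ e ∈ E, ∀ f ∈ E, e ⊆ f → e = f)
    (h_integral : IsIntegralClutter E)
    (h_cover : ∀ x : Fin n, ∃ e ∈ E, x ∈ e) :
    ∃ V : Fin d → Finset (Fin n),
      (∀ i, IsMinimalVertexCover E (V i)) ∧
      (∀ i j, i ≠ j → Disjoint (V i) (V j)) ∧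
      (∀ x : Fin n, ∃ i, x ∈ V i) ∧
      (∀ e ∈ E, ∀ i, (e ∩ V i).card = 1) := by
  obtain ⟨V, -, hdisj, hcov, hV⟩ := h_integral.exists_partition h_cover d Finset.univ
    fun e he => by rw [Finset.inter_univ, h_uniform e he]
  exact ⟨V, fun i => isMinimalVertexCover_of_card_inter_eq_one h_cover fun e he => hV e he i,
    hdisj, fun x => hcov x (Finset.mem_univ x), hV⟩
end

section
/- Let C be an integral d-uniform clutter on [n] whose edges cover [n], and let [n] = V_1 ∪ ⋯ ∪ V_d be a partition into pairwise disjoint minimal vertex covers (which exists by integrality), with r_i = |V_i|. Let P = {C ⊆ [n] : C contains some edge of C} be the characteristic poset of the edge ideal of C. Then d ≤ sdepth(P) ≤ d + (r_1 ⋯ r_d / |E(C)|) · Σ_{i=1}^{d} (r_i − 1)/2, where |E(C)| is the number of edges of C. -/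
/-- A partition of a family `P` of subsets of `[n]` into intervals `[C,D] = {S : C ⊆ S ⊆ D}`:
a finite collection of intervals, each contained in `P`, such that every member of `P`
lies in exactly one of them. -/
def IsIntervalPartition {n : ℕ} (P : Finset (Finset (Fin n)))
    (D : Finset (Finset (Fin n) × Finset (Fin n))) : Prop :=
  (∀ p ∈ D, p.1 ⊆ p.2) ∧
  (∀ p ∈ D, ∀ S : Finset (Fin n), p.1 ⊆ S → S ⊆ p.2 → S ∈ P) ∧
  (∀ S ∈ P, ∃! p : Finset (Fin n) × Finset (Fin n), p ∈ D ∧ p.1 ⊆ S ∧ S ⊆ p.2)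

/-- The Stanley depth of a family `P` of subsets of `[n]`: the maximum over all interval
partitions of `P` of the minimum cardinality of the top sets `D_j` of the intervals. -/
noncomputable def posetSdepth {n : ℕ} (P : Finset (Finset (Fin n))) : ℕ :=
  sSup {m | ∃ D, IsIntervalPartition P D ∧ ∀ p ∈ D, m ≤ p.2.card}

/-- The characteristic poset of the edge ideal of a clutter with edge set `E`:
all subsets of `[n]` containing some edge. -/
def charPoset {n : ℕ} (E : Finset (Finset (Fin n))) : Finset (Finset (Fin n)) :=
  Finset.univ.filter (fun C => ∃ e ∈ E, e ⊆ C)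

lemma mem_charPoset {n : ℕ} {E : Finset (Finset (Fin n))} {S : Finset (Fin n)} :
    S ∈ charPoset E ↔ ∃ e ∈ E, e ⊆ S := by
  simp [charPoset]

/-- The singleton intervals partition any family of sets. -/
lemma isIntervalPartition_diagonal {n : ℕ} (P : Finset (Finset (Fin n))) :
    IsIntervalPartition P (P.image fun S => (S, S)) := by
  refine ⟨?_, ?_, ?_⟩
  · intro p hp
    obtain ⟨S, -, rfl⟩ := Finset.mem_image.1 hp
    exact Finset.Subset.refl _
  · intro p hp T h₁ h₂
    obtain ⟨S, hS, rfl⟩ := Finset.mem_image.1 hp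
    rwa [Finset.Subset.antisymm h₂ h₁]
  · intro S hS
    refine ⟨(S, S), ⟨Finset.mem_image_of_mem _ hS, subset_rfl, subset_rfl⟩, ?_⟩
    rintro p ⟨hp, h₁, h₂⟩
    obtain ⟨T, -, rfl⟩ := Finset.mem_image.1 hp
    have hTS : T = S := Finset.Subset.antisymm h₁ h₂
    rw [hTS]

lemma bddAbove_sdepth_set {n : ℕ} {P : Finset (Finset (Fin n))} (hP : P.Nonempty) :
    BddAbove {m | ∃ D, IsIntervalPartition P D ∧ ∀ p ∈ D, m ≤ p.2.card} := by
  refine ⟨n, ?_⟩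
  rintro m ⟨D, hD, hm⟩
  obtain ⟨S, hS⟩ := hP
  obtain ⟨p, ⟨hp, -⟩, -⟩ := hD.2.2 S hS
  exact (hm p hp).trans (card_finset_fin_le _)

lemma le_posetSdepth {n d : ℕ} {P : Finset (Finset (Fin n))} (hP : P.Nonempty)
    (hd : ∀ S ∈ P, d ≤ S.card) : d ≤ posetSdepth P := by
  refine le_csSup (bddAbove_sdepth_set hP) ⟨_, isIntervalPartition_diagonal P, ?_⟩
  intro p hp
  obtain ⟨S, hS, rfl⟩ := Finset.mem_image.1 hp
  exact hd S hS

lemma exists_partition_posetSdepth {n : ℕ} {P : Finset (Finset (Fin n))} (hP : P.Nonempty) :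
    ∃ D, IsIntervalPartition P D ∧ ∀ p ∈ D, posetSdepth P ≤ p.2.card :=
  Nat.sSup_mem (s := {m | ∃ D, IsIntervalPartition P D ∧ ∀ p ∈ D, m ≤ p.2.card})
    ⟨0, _, isIntervalPartition_diagonal P, fun _ _ => Nat.zero_le _⟩ (bddAbove_sdepth_set hP)

/-- In an interval partition of the characteristic poset of a uniform clutter, every edge is
the bottom of its interval. -/
lemma exists_interval_of_edge {n d : ℕ} {E : Finset (Finset (Fin n))}
    (h_uniform : ∀ e ∈ E, e.card = d) {D : Finset (Finset (Fin n) × Finset (Fin n))}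
    (hD : IsIntervalPartition (charPoset E) D) {e : Finset (Fin n)} (he : e ∈ E) :
    ∃ T, (e, T) ∈ D := by
  obtain ⟨⟨C, T⟩, ⟨hp, hC, -⟩, -⟩ := hD.2.2 e (mem_charPoset.2 ⟨e, he, subset_rfl⟩)
  obtain ⟨f, hf, hfC⟩ := mem_charPoset.1 (hD.2.1 _ hp C subset_rfl (hD.1 _ hp))
  have hef : C = e := Finset.eq_of_subset_of_card_le hC
    (by rw [h_uniform e he, ← h_uniform f hf]; exact Finset.card_le_card hfC)
  exact ⟨T, hef ▸ hp⟩

/-- The edges of a `d`-uniform clutter, together with an interval partition all of whose tops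
have at least `k` elements, account for `|E| (k - d)` sets of size `d + 1`. -/
lemma card_mul_le_card_filter_of_partition {n d k : ℕ} {E : Finset (Finset (Fin n))}
    (h_uniform : ∀ e ∈ E, e.card = d) {D : Finset (Finset (Fin n) × Finset (Fin n))}
    (hD : IsIntervalPartition (charPoset E) D) (hk : ∀ p ∈ D, k ≤ p.2.card) :
    E.card * (k - d) ≤ ((charPoset E).filter fun S => S.card = d + 1).card := by
  choose! T hT using fun e (he : e ∈ E) => exists_interval_of_edge h_uniform hD he
  let B : Finset (Fin n) → Finset (Finset (Fin n)) :=
    fun e => (T e \ e).image fun x => insert x e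
  have hB_mem : ∀ e ∈ E, ∀ S ∈ B e, e ⊆ S ∧ S ⊆ T e ∧ S.card = d + 1 := by
    intro e he S hS
    obtain ⟨x, hx, rfl⟩ := Finset.mem_image.1 hS
    rw [Finset.mem_sdiff] at hx
    refine ⟨Finset.subset_insert _ _, Finset.insert_subset hx.1 (hD.1 _ (hT e he)), ?_⟩
    rw [Finset.card_insert_of_notMem hx.2, h_uniform e he]
  have hB_card : ∀ e ∈ E, k - d ≤ (B e).card := by
    intro e he
    rw [Finset.card_image_of_injOn, Finset.card_sdiff_of_subset (hD.1 _ (hT e he)),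
      h_uniform e he]
    · exact Nat.sub_le_sub_right (hk _ (hT e he)) d
    · intro x hx y hy hxy
      exact (Finset.insert_inj (Finset.mem_sdiff.1 hx).2).1 hxy
  have hB_disjoint : ∀ e ∈ E, ∀ f ∈ E, e ≠ f → Disjoint (B e) (B f) := by
    intro e he f hf hef
    rw [Finset.disjoint_left]
    intro S hSe hSf
    obtain ⟨he₁, he₂, -⟩ := hB_mem e he S hSe
    obtain ⟨hf₁, hf₂, -⟩ := hB_mem f hf S hSf
    exact hef (congrArg Prod.fst ((hD.2.2 S (mem_charPoset.2 ⟨e, he, he₁⟩)).unique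
      ⟨hT e he, he₁, he₂⟩ ⟨hT f hf, hf₁, hf₂⟩))
  calc E.card * (k - d) ≤ ∑ e ∈ E, (B e).card := by
        simpa using Finset.card_nsmul_le_sum E _ _ hB_card
    _ = (E.biUnion B).card := (Finset.card_biUnion hB_disjoint).symm
    _ ≤ _ := by
        refine Finset.card_le_card fun S hS => ?_
        obtain ⟨e, he, hSe⟩ := Finset.mem_biUnion.1 hS
        obtain ⟨h₁, -, h₃⟩ := hB_mem e he S hSe
        exact Finset.mem_filter.2 ⟨mem_charPoset.2 ⟨e, he, h₁⟩, h₃⟩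

/-- A choice of one element from each of a family of pairwise disjoint sets is injective. -/
lemma injective_of_mem_disjoint {ι α : Type*} {V : ι → Finset α}
    (hV : ∀ i j, i ≠ j → Disjoint (V i) (V j)) {f : ι → α} (hf : ∀ i, f i ∈ V i) :
    Function.Injective f := by
  intro i j hij
  by_contra hne
  exact Finset.disjoint_left.1 (hV i j hne) (hf i) (hij ▸ hf j)

/-- An edge of size `d` meeting `d` pairwise disjoint vertex covers is a transversal of them. -/
lemma exists_transversal_eq_edge {n d : ℕ} {E : Finset (Finset (Fin n))}
    (h_uniform : ∀ e ∈ E, e.card = d) {V : Fin d → Finset (Fin n)}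
    (hV_cover : ∀ i, IsVertexCover E (V i)) (hV_disjoint : ∀ i j, i ≠ j → Disjoint (V i) (V j))
    {e : Finset (Fin n)} (he : e ∈ E) :
    ∃ f : Fin d → Fin n, (∀ i, f i ∈ V i) ∧ Finset.univ.image f = e := by
  choose f hf using fun i => hV_cover i e he
  have hfV : ∀ i, f i ∈ V i := fun i => (Finset.mem_inter.1 (hf i)).2
  refine ⟨f, hfV, Finset.eq_of_subset_of_card_le ?_ ?_⟩
  · intro x hx
    obtain ⟨i, -, rfl⟩ := Finset.mem_image.1 hx
    exact (Finset.mem_inter.1 (hf i)).1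
  · rw [Finset.card_image_of_injective _ (injective_of_mem_disjoint hV_disjoint hfV),
      h_uniform e he]
    simp

/-- Each set of size `d + 1` containing an edge arises in at least two ways by adding a point to
a transversal of `V`. -/
lemma two_mul_card_filter_le {n d : ℕ} {E : Finset (Finset (Fin n))}
    (h_uniform : ∀ e ∈ E, e.card = d) {V : Fin d → Finset (Fin n)}
    (hV_cover : ∀ i, IsVertexCover E (V i)) (hV_disjoint : ∀ i j, i ≠ j → Disjoint (V i) (V j))
    (hV_union : ∀ x : Fin n, ∃ i, x ∈ V i) :
    2 * ((charPoset E).filter fun S => S.card = d + 1).card ≤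
      (∏ i, (V i).card) * (n - d) := by
  let Q : Finset ((_ : Fin d → Fin n) × Fin n) :=
    (Fintype.piFinset V).sigma fun f => Finset.univ \ Finset.univ.image f
  let g : ((_ : Fin d → Fin n) × Fin n) → Finset (Fin n) :=
    fun p => insert p.2 (Finset.univ.image p.1)
  have hQ : Q.card = (∏ i, (V i).card) * (n - d) := by
    rw [Finset.card_sigma, ← Fintype.card_piFinset, ← smul_eq_mul]
    refine Finset.sum_const_nat fun f hf => ?_
    rw [Finset.card_sdiff_of_subset (Finset.subset_univ _), Finset.card_image_of_injective _
      (injective_of_mem_disjoint hV_disjoint (Fintype.mem_piFinset.1 hf))]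
    simp
  have h_fiber : ∀ S ∈ (charPoset E).filter fun S => S.card = d + 1,
      2 ≤ (Q.filter fun p => g p = S).card := by
    intro S hS
    obtain ⟨hSE, hS⟩ := Finset.mem_filter.1 hS
    obtain ⟨e, he, heS⟩ := mem_charPoset.1 hSE
    obtain ⟨f, hfV, rfl⟩ := exists_transversal_eq_edge h_uniform hV_cover hV_disjoint he
    obtain ⟨x, hx, rfl⟩ : ∃ x, x ∉ Finset.univ.image f ∧ insert x (Finset.univ.image f) = S := by
      refine (Finset.covBy_iff_exists_insert).1 ?_
      rw [Finset.covBy_iff_card_sdiff_eq_one]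
      refine ⟨heS, ?_⟩
      rw [Finset.card_sdiff_of_subset heS, hS, h_uniform _ he]
      simp
    obtain ⟨i, hi⟩ := hV_union x
    have hfx : ∀ j, f j ≠ x := by simpa using hx
    have hf_inj := injective_of_mem_disjoint hV_disjoint hfV
    refine Finset.one_lt_card.2 ⟨⟨f, x⟩, ?_, ⟨Function.update f i x, f i⟩, ?_, ?_⟩
    · simp [Q, g, hfV, hfx]
    · simp only [Q, g, Finset.mem_filter, Finset.mem_sigma, Fintype.mem_piFinset,
        Finset.mem_sdiff, Finset.mem_univ, true_and, Finset.mem_image, not_exists]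
      refine ⟨⟨fun j => ?_, fun j hj => ?_⟩, ?_⟩
      · rcases eq_or_ne j i with rfl | hj
        · simpa using hi
        · simpa [hj] using hfV j
      · rcases eq_or_ne j i with rfl | hji
        · exact hfx j (by simpa using hj.symm)
        · exact hji (hf_inj (by simpa [hji] using hj))
      · ext y
        simp only [Finset.mem_insert, Finset.mem_image, Finset.mem_univ, true_and]
        constructor
        · rintro (rfl | ⟨j, rfl⟩)
          · exact Or.inr ⟨i, rfl⟩
          · rcases eq_or_ne j i with rfl | hj
            · simp
            · exact Or.inr ⟨j, by simp [hj]⟩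
        · rintro (rfl | ⟨j, rfl⟩)
          · exact Or.inr ⟨i, by simp⟩
          · rcases eq_or_ne j i with rfl | hj
            · exact Or.inl rfl
            · exact Or.inr ⟨j, by simp [hj]⟩
    · intro h
      exact hfx i (congrArg Sigma.snd h).symm
  rw [← hQ, mul_comm]
  calc _ ≤ ∑ S ∈ (charPoset E).filter fun S => S.card = d + 1,
          (Q.filter fun p => g p = S).card := by
        simpa using Finset.card_nsmul_le_sum _ _ _ h_fiber
    _ ≤ Q.card := by
        rw [Finset.sum_card_fiberwise_eq_card_filter]
        exact Finset.card_filter_le _ _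

/-- Let `C` be an integral `d`-uniform clutter on `[n]` whose edges cover `[n]`, and let
`[n] = V 0 ∪ ⋯ ∪ V (d-1)` be a partition into pairwise disjoint minimal vertex covers with
`r i = |V i|`. Let `P` be the characteristic poset of the edge ideal of `C`. Then
`d ≤ sdepth P ≤ d + (r 0 ⋯ r (d-1) / |E|) · Σ_i (r i − 1)/2`. -/
theorem sdepth_integral_uniform_clutter_bounds {n d : ℕ} (hd : 1 ≤ d)
    (E : Finset (Finset (Fin n))) (hE : E.Nonempty)
    (h_uniform : ∀ e ∈ E, e.card = d)
    (h_antichain : ∀ e ∈ E, ∀ f ∈ E, e ⊆ f → e = f)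
    (h_integral : IsIntegralClutter E)
    (h_cover : ∀ x : Fin n, ∃ e ∈ E, x ∈ e)
    (V : Fin d → Finset (Fin n))
    (hV_cover : ∀ i, IsMinimalVertexCover E (V i))
    (hV_disjoint : ∀ i j, i ≠ j → Disjoint (V i) (V j))
    (hV_union : ∀ x : Fin n, ∃ i, x ∈ V i)
    (r : Fin d → ℕ) (hr : ∀ i, r i = (V i).card) :
    d ≤ posetSdepth (charPoset E) ∧
      (posetSdepth (charPoset E) : ℚ) ≤
        d + ((∏ i, (r i : ℚ)) / (E.card : ℚ)) * ∑ i, ((r i : ℚ) - 1) / 2 := by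
  have h_card : ∀ S ∈ charPoset E, d ≤ S.card := by
    intro S hS
    obtain ⟨e, he, heS⟩ := mem_charPoset.1 hS
    exact h_uniform e he ▸ Finset.card_le_card heS
  have hP : (charPoset E).Nonempty :=
    hE.imp fun e he => mem_charPoset.2 ⟨e, he, subset_rfl⟩
  have hd_le := le_posetSdepth hP h_card
  refine ⟨hd_le, ?_⟩
  obtain ⟨D, hD, hk⟩ := exists_partition_posetSdepth hP
  have hn : n = ∑ i, r i := by
    have h_union : Finset.univ.biUnion V = Finset.univ := by
      ext x
      simpa using hV_union x
    simp_rw [hr]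
    rw [← Finset.card_biUnion fun i _ j _ => hV_disjoint i j, h_union, Finset.card_fin]
  have hdn : d ≤ n := by
    obtain ⟨e, he⟩ := hE
    exact h_uniform e he ▸ card_finset_fin_le e
  have h_count : 2 * (E.card * (posetSdepth (charPoset E) - d)) ≤ (∏ i, r i) * (n - d) := by
    simp_rw [hr]
    exact (Nat.mul_le_mul_left 2 (card_mul_le_card_filter_of_partition h_uniform hD hk)).trans
      (two_mul_card_filter_le h_uniform (fun i => (hV_cover i).1) hV_disjoint hV_union)
  have h_sum : ∑ i, ((r i : ℚ) - 1) / 2 = ((n : ℚ) - d) / 2 := by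
    rw [← Finset.sum_div, Finset.sum_sub_distrib, hn]
    simp
  have hE_pos : (0 : ℚ) < E.card := by exact_mod_cast hE.card_pos
  have h_count' : 2 * ((E.card : ℚ) * (posetSdepth (charPoset E) - d)) ≤
      (∏ i, (r i : ℚ)) * (n - d) := by
    have := (Nat.cast_le (α := ℚ)).2 h_count
    push_cast [Nat.cast_sub hd_le, Nat.cast_sub hdn] at this
    exact this
  rw [h_sum, ← sub_le_iff_le_add', div_mul_eq_mul_div, le_div_iff₀ hE_pos]
  linarith
end
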